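/- Assume the chain is transient, i.e. D(0,∞) < ∞, and that p_R → 0 as R → ∞. Then for every x > 0, lim_{R→∞} P( ξ(R,∞)/(2 D(R,∞)) > x ) = e^{−x} and lim_{R→∞} P( ξ(R,∞,↑)/D(R,∞) > x ) = e^{−x}; that is, ξ(R,∞)/(2D(R,∞)) and ξ(R,∞,↑)/D(R,∞) have exponential limiting distributions. -/

import Mathlib

open MeasureTheory Filter Finset
open scoped ENNReal NNReal Topology

noncomputable section

namespace NNRW

/-- Probability of a step to the right from site `i`: `E 0 = 1`, `E i = 1/2 + p i` for `i ≥ 1`. -/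
def E (p : ℕ → ℝ) (i : ℕ) : ℝ := if i = 0 then 1 else 1 / 2 + p i

/-- One-step transition probability of the nearest-neighbour walk, from `i` to `j`. -/
def step (p : ℕ → ℝ) (i j : ℕ) : ℝ :=
  if j = i + 1 then E p i else if j + 1 = i then 1 - E p i else 0

/-- `X` is (distributed as) the nearest-neighbour Markov chain with parameters `p`, started
at `b`, under the probability measure `P`: `X 0 = b` and the finite-dimensional
distributions are the products of the one-step transition probabilities. -/
def IsNNWalk {Ω : Type*} [MeasurableSpace Ω] (P : Measure Ω)
    (X : ℕ → Ω → ℕ) (p : ℕ → ℝ) (b : ℕ) : Prop :=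
  (∀ ω, X 0 ω = b) ∧
    ∀ (n : ℕ) (u : ℕ → ℕ), u 0 = b →
      P {ω | ∀ k ≤ n, X k ω = u k} =
        ENNReal.ofReal (∏ k ∈ Finset.range n, step p (u k) (u (k + 1)))

/-- `U i = (1/2 - p i)/(1/2 + p i)`. -/
def U (p : ℕ → ℝ) (i : ℕ) : ℝ := (1 / 2 - p i) / (1 / 2 + p i)

/-- `D(m,n)` for finite `m ≤ n`. -/
def Dfin (p : ℕ → ℝ) (m n : ℕ) : ℝ :=
  if n = m then 0
  else 1 + ∑ j ∈ Finset.Icc 1 (n - m - 1), ∏ i ∈ Finset.Icc 1 j, U p (m + i)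

/-- `D(m,∞) = lim_{n → ∞} D(m,n) ∈ (0,∞]`. -/
def Dinf (p : ℕ → ℝ) (m : ℕ) : ℝ≥0∞ :=
  1 + ∑' j : ℕ, ENNReal.ofReal (∏ i ∈ Finset.Icc 1 (j + 1), U p (m + i))

/-- Event: the walk visits `a` (strictly) before it ever visits `c`. -/
def hitsBefore {Ω : Type*} (X : ℕ → Ω → ℕ) (a c : ℕ) : Set Ω :=
  {ω | ∃ n, X n ω = a ∧ ∀ k < n, X k ω ≠ c}

/-- Event: the walk ever visits `a`. -/
def hits {Ω : Type*} (X : ℕ → Ω → ℕ) (a : ℕ) : Set Ω := {ω | ∃ n, X n ω = a}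

/-- Total local time `ξ(x,∞)` at site `x` (equal to `∞` if there are infinitely many
visits). -/
def localTime {Ω : Type*} (X : ℕ → Ω → ℕ) (x : ℕ) (ω : Ω) : ℝ≥0∞ :=
  ∑' k : ℕ, Set.indicator {k | X k ω = x} (fun _ => (1 : ℝ≥0∞)) k

/-- Total number of upcrossings `ξ(x,∞,↑)` at site `x`. -/
def upcross {Ω : Type*} (X : ℕ → Ω → ℕ) (x : ℕ) (ω : Ω) : ℝ≥0∞ :=
  ∑' k : ℕ, Set.indicator {k | X k ω = x ∧ X (k + 1) ω = x + 1} (fun _ => (1 : ℝ≥0∞)) k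

/-- Iterated logarithm: `iterLog 0 x = x`, `iterLog (k+1) x = log (iterLog k x)`. -/
def iterLog : ℕ → ℝ → ℝ
  | 0, x => x
  | k + 1, x => Real.log (iterLog k x)

/-- `λ(k,x)`: `lam 0 x = 1`, `lam (k+1) x = lam k x * log_k x`. -/
def lam : ℕ → ℝ → ℝ
  | 0, _ => 1
  | k + 1, x => lam k x * iterLog k x

/-- `Λ(K,x,B) = Λ(K-1,x) + B/λ(K,x)` where `Λ(K,x) = ∑_{k=1}^{K} 1/λ(k,x)`. -/
def LamB (K : ℕ) (B : ℝ) (x : ℝ) : ℝ :=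
  (∑ k ∈ Finset.Icc 1 (K - 1), 1 / lam k x) + B / lam K x

/-- The truncation convention: with `i₀ = min{i ≥ 1 : q i < 1/2}` one has `p i = q i₀`
for `1 ≤ i ≤ i₀` and `p i = q i` for `i > i₀`. -/
def IsTruncation (q p : ℕ → ℝ) : Prop :=
  ∃ i0 : ℕ, 1 ≤ i0 ∧ q i0 < 1 / 2 ∧ (∀ i, 1 ≤ i → i < i0 → ¬ q i < 1 / 2) ∧
    (∀ i, 1 ≤ i → i ≤ i0 → p i = q i0) ∧ ∀ i, i0 < i → p i = q i

end NNRW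

open NNRW

namespace NNRW

section Measurability

variable {Ω : Type*} [MeasurableSpace Ω]

theorem nullMeasurableSet_left_of_measure_add_le {μ : Measure Ω} {A B : Set Ω}
    (hAB : NullMeasurableSet (A ∪ B) μ) (h : μ A + μ B ≤ μ (A ∪ B)) (hfin : μ (A ∪ B) ≠ ∞) :
    NullMeasurableSet A μ := by
  set A' := toMeasurable μ A with hA'
  set B' := toMeasurable μ B with hB'
  have hinter : μ (A' ∩ B') = 0 := by
    have h1 := measure_union_add_inter (μ := μ) A' (measurableSet_toMeasurable μ B)
    rw [← hB', hA', measure_toMeasurable, ← hA', hB', measure_toMeasurable, ← hB'] at h1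
    have h2 : μ (A ∪ B) ≤ μ (A' ∪ B') :=
      measure_mono (Set.union_subset_union (subset_toMeasurable μ A) (subset_toMeasurable μ B))
    have h3 : μ (A ∪ B) + μ (A' ∩ B') ≤ μ (A ∪ B) + 0 := by
      rw [add_zero]
      exact (add_le_add_left h2 _).trans (h1.trans_le h)
    exact le_antisymm ((ENNReal.add_le_add_iff_left hfin).1 h3) zero_le
  have hsub : (A' ∩ (A ∪ B)) \ A ⊆ A' ∩ B' := by
    rintro ω ⟨⟨h1, h2⟩, h3⟩
    exact ⟨h1, subset_toMeasurable μ B (h2.resolve_left h3)⟩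
  have hnull : NullMeasurableSet ((A' ∩ (A ∪ B)) \ A) μ :=
    NullMeasurableSet.of_null (measure_mono_null hsub hinter)
  have hA : A = (A' ∩ (A ∪ B)) \ ((A' ∩ (A ∪ B)) \ A) := by
    rw [Set.sdiff_sdiff_cancel_left]
    exact Set.subset_inter (subset_toMeasurable μ A) Set.subset_union_left
  rw [hA]
  exact ((measurableSet_toMeasurable μ A).nullMeasurableSet.inter hAB).diff hnull

end Measurability

section Walk

/-- The path of the walk up to time `n`. -/
def path {Ω : Type*} (X : ℕ → Ω → ℕ) (n : ℕ) (ω : Ω) : Fin (n + 1) → ℕ := fun k => X k ω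

theorem setOf_path_eq {Ω : Type*} {X : ℕ → Ω → ℕ} (n : ℕ) (v : Fin (n + 1) → ℕ) :
    {ω | path X n ω = v} = {ω | ∀ k ≤ n, X k ω = if h : k < n + 1 then v ⟨k, h⟩ else 0} := by
  ext ω
  simp only [Set.mem_ofPred_eq, funext_iff, path]
  constructor
  · intro h k hk
    rw [dif_pos (Nat.lt_succ_of_le hk)]
    exact h ⟨k, Nat.lt_succ_of_le hk⟩
  · intro h k
    rw [h k (Nat.le_of_lt_succ k.2), dif_pos k.2]

variable {p : ℕ → ℝ}

theorem E_nonneg (hp : ∀ i, 1 ≤ i → 0 ≤ p i ∧ p i < 1 / 2) (i : ℕ) : 0 ≤ E p i := by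
  unfold E
  split_ifs with h
  · exact zero_le_one
  · linarith [(hp i (Nat.one_le_iff_ne_zero.2 h)).1]

theorem E_le_one (hp : ∀ i, 1 ≤ i → 0 ≤ p i ∧ p i < 1 / 2) (i : ℕ) : E p i ≤ 1 := by
  unfold E
  split_ifs with h
  · exact le_rfl
  · linarith [(hp i (Nat.one_le_iff_ne_zero.2 h)).2]

theorem step_nonneg (hp : ∀ i, 1 ≤ i → 0 ≤ p i ∧ p i < 1 / 2) (i j : ℕ) : 0 ≤ step p i j := by
  unfold step
  split_ifs
  · exact E_nonneg hp i
  · linarith [E_le_one hp i]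
  · exact le_rfl

theorem tsum_step_mul (p : ℕ → ℝ) (i : ℕ) (f : ℕ → ℝ≥0∞) :
    ∑' j, ENNReal.ofReal (step p i j) * f j =
      ENNReal.ofReal (E p i) * f (i + 1) + ENNReal.ofReal (1 - E p i) * f (i - 1) := by
  rw [tsum_eq_sum (s := {i + 1, i - 1}), Finset.sum_pair (by omega)]
  · congr 1
    · simp [step]
    · rcases Nat.eq_zero_or_pos i with rfl | hi
      · simp [step, E]
      · rw [step, if_neg (by omega), if_pos (by omega)]
  · intro j hj
    simp only [Finset.mem_insert, Finset.mem_singleton, not_or] at hj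
    rw [step, if_neg hj.1, if_neg (by omega), ENNReal.ofReal_zero, zero_mul]

theorem tsum_step (hp : ∀ i, 1 ≤ i → 0 ≤ p i ∧ p i < 1 / 2) (i : ℕ) :
    ∑' j, ENNReal.ofReal (step p i j) = 1 := by
  have h := tsum_step_mul p i (fun _ => 1)
  simp only [mul_one] at h
  rw [h, ← ENNReal.ofReal_add (E_nonneg hp i) (by linarith [E_le_one hp i])]
  simp

variable {Ω : Type*} [MeasurableSpace Ω] {P : Measure Ω} {X : ℕ → Ω → ℕ} {b : ℕ}

theorem IsNNWalk.measure_cylinder_inter (hp : ∀ i, 1 ≤ i → 0 ≤ p i ∧ p i < 1 / 2)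
    (hX : IsNNWalk P X p b) (n : ℕ) (u : ℕ → ℕ) (j : ℕ) :
    P ({ω | ∀ k ≤ n, X k ω = u k} ∩ {ω | X (n + 1) ω = j}) =
      P {ω | ∀ k ≤ n, X k ω = u k} * ENNReal.ofReal (step p (u n) j) := by
  by_cases hu : u 0 = b
  · have hset : {ω | ∀ k ≤ n, X k ω = u k} ∩ {ω | X (n + 1) ω = j} =
        {ω | ∀ k ≤ n + 1, X k ω = Function.update u (n + 1) j k} := by
      ext ω
      constructor
      · rintro ⟨h1, h2⟩ k hk
        rcases Nat.le_succ_iff.1 hk with h | rfl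
        · rw [Function.update_of_ne (by omega)]
          exact h1 k h
        · rw [Function.update_self]
          exact h2
      · intro h
        refine ⟨fun k hk => ?_, ?_⟩
        · have := h k (by omega)
          rwa [Function.update_of_ne (by omega)] at this
        · have := h (n + 1) le_rfl
          rwa [Function.update_self] at this
    rw [hset, hX.2 (n + 1) _ (by rw [Function.update_of_ne (by omega), hu]), hX.2 n u hu,
      Finset.prod_range_succ, ENNReal.ofReal_mul]
    · congr 2
      · refine Finset.prod_congr rfl fun k hk => ?_
        have := Finset.mem_range.1 hk
        rw [Function.update_of_ne (by omega), Function.update_of_ne (by omega)]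
      · rw [Function.update_of_ne (by omega), Function.update_self]
    · exact Finset.prod_nonneg fun k _ => step_nonneg hp _ _
  · have hempty : {ω | ∀ k ≤ n, X k ω = u k} = ∅ := by
      ext ω
      simp only [Set.mem_ofPred_eq, Set.mem_empty_iff_false, iff_false]
      exact fun h => hu ((h 0 (Nat.zero_le _)).symm.trans (hX.1 ω))
    simp [hempty]

theorem IsNNWalk.nullMeasurableSet_cylinder [IsFiniteMeasure P]
    (hp : ∀ i, 1 ≤ i → 0 ≤ p i ∧ p i < 1 / 2) (hX : IsNNWalk P X p b) (n : ℕ) (u : ℕ → ℕ) :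
    NullMeasurableSet {ω | ∀ k ≤ n, X k ω = u k} P := by
  induction n with
  | zero =>
    simp only [Nat.le_zero, forall_eq, hX.1]
    exact MeasurableSet.const _ |>.nullMeasurableSet
  | succ n ih =>
    set C := {ω | ∀ k ≤ n, X k ω = u k} with hC
    set A : ℕ → Set Ω := fun j => C ∩ {ω | X (n + 1) ω = j} with hA
    have hset : {ω | ∀ k ≤ n + 1, X k ω = u k} = A (u (n + 1)) := by
      ext ω
      refine ⟨fun h => ⟨fun k hk => h k (by omega), h (n + 1) le_rfl⟩, ?_⟩
      rintro ⟨h1, h2⟩ k hk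
      rcases Nat.le_succ_iff.1 hk with h | rfl
      · exact h1 k h
      · exact h2
    set B : Set Ω := C ∩ {ω | X (n + 1) ω ≠ u (n + 1)} with hB
    have hunion : A (u (n + 1)) ∪ B = C := by
      rw [hA, hB, ← Set.inter_union_distrib_left, Set.inter_eq_left]
      exact fun ω _ => em _
    have hBle : P B ≤ ∑' j, if j = u (n + 1) then 0 else P (A j) := by
      have hsub : B ⊆ ⋃ j, if j = u (n + 1) then ∅ else A j := by
        rintro ω ⟨h1, h2⟩
        refine Set.mem_iUnion.2 ⟨X (n + 1) ω, ?_⟩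
        rw [if_neg h2]
        exact ⟨h1, rfl⟩
      refine (measure_mono hsub).trans ((measure_iUnion_le _).trans_eq ?_)
      refine tsum_congr fun j => ?_
      split_ifs <;> simp
    have hsum : ∑' j, P (A j) = P C := by
      simp only [hA, hC, hX.measure_cylinder_inter hp]
      rw [ENNReal.tsum_mul_left, tsum_step hp, mul_one]
    have hle : P (A (u (n + 1))) + P B ≤ P C := by
      rw [← hsum, ENNReal.tsum_eq_add_tsum_ite (u (n + 1))]
      refine add_le_add_right (hBle.trans_eq (tsum_congr fun j => ?_)) _
      congr
    rw [hset]
    refine nullMeasurableSet_left_of_measure_add_le (B := B) ?_ ?_ (measure_ne_top _ _)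
    · rwa [hunion]
    · rwa [hunion]

theorem IsNNWalk.aemeasurable [IsFiniteMeasure P]
    (hp : ∀ i, 1 ≤ i → 0 ≤ p i ∧ p i < 1 / 2) (hX : IsNNWalk P X p b) (n : ℕ) :
    AEMeasurable (X n) P := by
  refine NullMeasurable.aemeasurable fun s _ => ?_
  have hset : X n ⁻¹' s =
      ⋃ v : {v : Fin (n + 1) → ℕ // v (Fin.last n) ∈ s}, {ω | path X n ω = v} := by
    ext ω
    simp only [Set.mem_preimage, Set.mem_iUnion, Set.mem_ofPred_eq]
    constructor
    · exact fun h => ⟨⟨path X n ω, h⟩, rfl⟩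
    · rintro ⟨⟨v, hv⟩, rfl⟩
      exact hv
  rw [hset]
  refine NullMeasurableSet.iUnion fun v => ?_
  rw [setOf_path_eq]
  exact hX.nullMeasurableSet_cylinder hp n _

theorem IsNNWalk.aemeasurable_path [IsFiniteMeasure P]
    (hp : ∀ i, 1 ≤ i → 0 ≤ p i ∧ p i < 1 / 2) (hX : IsNNWalk P X p b) (n : ℕ) :
    AEMeasurable (path X n) P :=
  aemeasurable_pi_lambda _ fun k => hX.aemeasurable hp k

theorem IsNNWalk.measure_path_inter (hp : ∀ i, 1 ≤ i → 0 ≤ p i ∧ p i < 1 / 2)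
    (hX : IsNNWalk P X p b) (n : ℕ) (v : Fin (n + 1) → ℕ) (j : ℕ) :
    P ({ω | path X n ω = v} ∩ {ω | X (n + 1) ω = j}) =
      P {ω | path X n ω = v} * ENNReal.ofReal (step p (v (Fin.last n)) j) := by
  rw [setOf_path_eq, hX.measure_cylinder_inter hp, dif_pos (Nat.lt_succ_self n)]
  rfl

/-- The Markov property, in integrated form. -/
theorem IsNNWalk.lintegral_succ [IsFiniteMeasure P]
    (hp : ∀ i, 1 ≤ i → 0 ≤ p i ∧ p i < 1 / 2) (hX : IsNNWalk P X p b) (n : ℕ)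
    (φ : (Fin (n + 1) → ℕ) → ℕ → ℝ≥0∞) :
    ∫⁻ ω, φ (path X n ω) (X (n + 1) ω) ∂P =
      ∫⁻ ω, ∑' j, ENNReal.ofReal (step p (X n ω) j) * φ (path X n ω) j ∂P := by
  have hpath := hX.aemeasurable_path hp n
  have hpair : AEMeasurable (fun ω => (path X n ω, X (n + 1) ω)) P :=
    hpath.prodMk (hX.aemeasurable hp (n + 1))
  have h1 := lintegral_map' (f := fun z : (Fin (n + 1) → ℕ) × ℕ => φ z.1 z.2)
    (measurable_of_countable _).aemeasurable hpair
  have h2 := lintegral_map' (f := fun v : Fin (n + 1) → ℕ =>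
    ∑' j, ENNReal.ofReal (step p (v (Fin.last n)) j) * φ v j)
    (measurable_of_countable _).aemeasurable hpath
  refine h1.symm.trans (Eq.trans ?_ h2)
  rw [lintegral_countable', lintegral_countable', ENNReal.tsum_prod']
  refine tsum_congr fun v => ?_
  rw [← ENNReal.tsum_mul_right]
  refine tsum_congr fun j => ?_
  rw [Measure.map_apply_of_aemeasurable hpair (measurableSet_singleton _),
    Measure.map_apply_of_aemeasurable hpath (measurableSet_singleton _)]
  have hset : (fun ω => (path X n ω, X (n + 1) ω)) ⁻¹' {(v, j)} =
      {ω | path X n ω = v} ∩ {ω | X (n + 1) ω = j} := by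
    ext ω
    simp
  rw [hset, hX.measure_path_inter hp]
  have hset' : path X n ⁻¹' {v} = {ω | path X n ω = v} := rfl
  rw [hset']
  ring

end Walk

end NNRW

namespace NNRW

section Counting

/-- The number of the first `n` steps of the walk which satisfy `c`. -/
def count {Ω : Type*} (c : ℕ → ℕ → Prop) [∀ i j, Decidable (c i j)] (X : ℕ → Ω → ℕ) (n : ℕ)
    (ω : Ω) : ℕ :=
  ∑ k ∈ Finset.range n, if c (X k ω) (X (k + 1) ω) then 1 else 0

theorem count_mono {Ω : Type*} (c : ℕ → ℕ → Prop) [∀ i j, Decidable (c i j)] (X : ℕ → Ω → ℕ)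
    (ω : Ω) : Monotone fun n => count c X n ω := fun _ _ h =>
  Finset.sum_le_sum_of_subset (Finset.range_subset_range.2 h)

variable {p : ℕ → ℝ} (c : ℕ → ℕ → Prop) [∀ i j, Decidable (c i j)]

/-- The mean of `h` after one step of the walk together with its counter, from `(i, k)`. -/
def next (p : ℕ → ℝ) (h : ℕ → ℕ → ℝ) (i k : ℕ) : ℝ :=
  E p i * h (i + 1) (k + if c i (i + 1) then 1 else 0) +
    (1 - E p i) * h (i - 1) (k + if c i (i - 1) then 1 else 0)

variable {Ω : Type*} [MeasurableSpace Ω] {P : Measure Ω} {X : ℕ → Ω → ℕ} {b : ℕ}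

theorem IsNNWalk.aemeasurable_count [IsFiniteMeasure P]
    (hp : ∀ i, 1 ≤ i → 0 ≤ p i ∧ p i < 1 / 2) (hX : IsNNWalk P X p b) (n : ℕ) :
    AEMeasurable (count c X n) P := by
  refine Finset.aemeasurable_fun_sum _ fun k _ => ?_
  exact (measurable_of_countable fun z : ℕ × ℕ => if c z.1 z.2 then 1 else 0).comp_aemeasurable
    ((hX.aemeasurable hp k).prodMk (hX.aemeasurable hp (k + 1)))

theorem IsNNWalk.aemeasurable_comp_count [IsFiniteMeasure P] {β : Type*} [MeasurableSpace β]
    (hp : ∀ i, 1 ≤ i → 0 ≤ p i ∧ p i < 1 / 2) (hX : IsNNWalk P X p b) (n : ℕ) (h : ℕ → ℕ → β) :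
    AEMeasurable (fun ω => h (X n ω) (count c X n ω)) P :=
  (measurable_of_countable fun z : ℕ × ℕ => h z.1 z.2).comp_aemeasurable
    ((hX.aemeasurable hp n).prodMk (hX.aemeasurable_count c hp n))

theorem IsNNWalk.lintegral_count_succ [IsFiniteMeasure P]
    (hp : ∀ i, 1 ≤ i → 0 ≤ p i ∧ p i < 1 / 2) (hX : IsNNWalk P X p b)
    {h : ℕ → ℕ → ℝ} (h0 : ∀ i k, 0 ≤ h i k) (n : ℕ) :
    ∫⁻ ω, ENNReal.ofReal (h (X (n + 1) ω) (count c X (n + 1) ω)) ∂P =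
      ∫⁻ ω, ENNReal.ofReal (next c p h (X n ω) (count c X n ω)) ∂P := by
  let φ : (Fin (n + 1) → ℕ) → ℕ → ℝ≥0∞ := fun v j => ENNReal.ofReal
    (h j ((∑ k : Fin n, if c (v k.castSucc) (v k.succ) then 1 else 0) +
      if c (v (Fin.last n)) j then 1 else 0))
  have hφ : ∀ ω j, φ (path X n ω) j =
      ENNReal.ofReal (h j (count c X n ω + if c (X n ω) j then 1 else 0)) := fun ω j => by
    simp only [φ, path, count, Finset.sum_range, Fin.val_castSucc, Fin.val_succ, Fin.val_last]
    rfl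
  have hs : ∀ ω, count c X (n + 1) ω =
      count c X n ω + if c (X n ω) (X (n + 1) ω) then 1 else 0 := fun ω =>
    Finset.sum_range_succ _ _
  have hmarkov := hX.lintegral_succ hp n φ
  simp only [hφ] at hmarkov
  simp only [hs]
  rw [hmarkov]
  refine lintegral_congr fun ω => ?_
  have hE := E_nonneg hp (X n ω)
  have hE' : 0 ≤ 1 - E p (X n ω) := sub_nonneg.2 (E_le_one hp (X n ω))
  rw [tsum_step_mul, next, ENNReal.ofReal_add (mul_nonneg hE (h0 _ _)) (mul_nonneg hE' (h0 _ _)),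
    ENNReal.ofReal_mul hE, ENNReal.ofReal_mul hE']

/-- If a bounded function `g` loses at least `δ` in mean at `j` and never increases in mean, the
walk visits `j` at time `n` with probability tending to `0`. -/
theorem IsNNWalk.tendsto_measure_eq [IsProbabilityMeasure P]
    (hp : ∀ i, 1 ≤ i → 0 ≤ p i ∧ p i < 1 / 2) (hX : IsNNWalk P X p b) {g : ℕ → ℝ} (j : ℕ)
    (hg : ∀ i, 0 ≤ g i) {δ : ℝ} (hδ : 0 < δ)
    (hdrop : ∀ i, E p i * g (i + 1) + (1 - E p i) * g (i - 1) + (if i = j then δ else 0) ≤ g i) :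
    Tendsto (fun n => P {ω | X n ω = j}) atTop (𝓝 0) := by
  have hstep : ∀ n, ∫⁻ ω, ENNReal.ofReal (g (X (n + 1) ω)) ∂P +
      ENNReal.ofReal δ * P {ω | X n ω = j} ≤ ∫⁻ ω, ENNReal.ofReal (g (X n ω)) ∂P := by
    intro n
    have h1 := hX.lintegral_count_succ (fun _ _ => False) hp (h := fun i _ => g i)
      (fun i _ => hg i) n
    rw [h1]
    have h2 : ENNReal.ofReal δ * P {ω | X n ω = j} =
        ∫⁻ ω, {ω | X n ω = j}.indicator (fun _ => ENNReal.ofReal δ) ω ∂P := by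
      rw [lintegral_indicator_const₀]
      exact (hX.aemeasurable hp n).nullMeasurableSet_preimage (measurableSet_singleton j)
    rw [h2, ← lintegral_add_left']
    · refine lintegral_mono fun ω => ?_
      have h3 : 0 ≤ next (fun _ _ => False) p (fun i _ => g i) (X n ω)
          (count (fun _ _ => False) X n ω) :=
        add_nonneg (mul_nonneg (E_nonneg hp _) (hg _))
          (mul_nonneg (sub_nonneg.2 (E_le_one hp _)) (hg _))
      have h4 : {ω | X n ω = j}.indicator (fun _ => ENNReal.ofReal δ) ω =
          ENNReal.ofReal (if X n ω = j then δ else 0) := by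
        by_cases h : X n ω = j <;> simp [h]
      simp only [h4]
      rw [← ENNReal.ofReal_add h3 (by split_ifs <;> positivity)]
      exact ENNReal.ofReal_le_ofReal (hdrop (X n ω))
    · exact hX.aemeasurable_comp_count (fun _ _ => False) hp n
        (fun i k => ENNReal.ofReal (next (fun _ _ => False) p (fun i _ => g i) i k))
  have hsum : ∀ N, ∫⁻ ω, ENNReal.ofReal (g (X N ω)) ∂P +
      ∑ n ∈ Finset.range N, ENNReal.ofReal δ * P {ω | X n ω = j} ≤ ENNReal.ofReal (g b) := by
    intro N
    induction N with
    | zero => simp [hX.1]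
    | succ N ih =>
      rw [Finset.sum_range_succ, add_comm (∑ n ∈ Finset.range N, _), ← add_assoc]
      exact (add_le_add_left (hstep N) _).trans ih
  have htsum : ∑' n, ENNReal.ofReal δ * P {ω | X n ω = j} ≤ ENNReal.ofReal (g b) := by
    rw [ENNReal.tsum_eq_iSup_nat]
    exact iSup_le fun N => le_add_self.trans (hsum N)
  refine ENNReal.tendsto_atTop_zero_of_tsum_ne_top fun htop => ?_
  rw [ENNReal.tsum_mul_left, htop, ENNReal.mul_top (by simpa using hδ)] at htsum
  exact ENNReal.ofReal_ne_top (top_le_iff.1 htsum)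

/-- A bounded harmonic function of the walk and its counter, equal to `1` once the counter exceeds
`m` and vanishing at infinity before, is the probability that the counter ever exceeds `m`. -/
theorem IsNNWalk.measure_exists_lt_count [IsProbabilityMeasure P]
    (hp : ∀ i, 1 ≤ i → 0 ≤ p i ∧ p i < 1 / 2) (hX : IsNNWalk P X p b)
    (hvanish : ∀ j, Tendsto (fun n => P {ω | X n ω = j}) atTop (𝓝 0))
    {h : ℕ → ℕ → ℝ} {a : ℕ → ℝ} {m : ℕ} (h0 : ∀ i k, 0 ≤ h i k) (h1 : ∀ i k, m < k → h i k = 1)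
    (hle : ∀ i k, h i k ≤ 1) (ha : ∀ i k, k ≤ m → h i k ≤ a i) (ha0 : Tendsto a atTop (𝓝 0))
    (hharm : ∀ i k, next c p h i k = h i k) :
    P {ω | ∃ n, m < count c X n ω} = ENNReal.ofReal (h b 0) := by
  have hconst : ∀ n, ∫⁻ ω, ENNReal.ofReal (h (X n ω) (count c X n ω)) ∂P =
      ENNReal.ofReal (h b 0) := by
    intro n
    induction n with
    | zero => simp [hX.1, count]
    | succ n ih =>
      rw [hX.lintegral_count_succ c hp h0]
      simpa only [hharm] using ih
  have hmono : Monotone fun n => {ω | m < count c X n ω} :=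
    fun n n' hn ω (hω : m < _) => hω.trans_le (count_mono c X ω hn)
  have hlim : Tendsto (fun n => P {ω | m < count c X n ω}) atTop
      (𝓝 (P {ω | ∃ n, m < count c X n ω})) := by
    have := tendsto_measure_iUnion_atTop (μ := P) hmono
    rwa [← Set.ofPred_exists] at this
  have hmeas : ∀ n, NullMeasurableSet {ω | m < count c X n ω} P := fun n =>
    (hX.aemeasurable_count c hp n).nullMeasurableSet_preimage measurableSet_Ioi
  refine le_antisymm (le_of_tendsto' hlim fun n => ?_) ?_
  · rw [← hconst n, ← lintegral_indicator_one₀ (hmeas n)]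
    refine lintegral_mono fun ω => ?_
    by_cases hω : m < count c X n ω
    · simp [hω, h1 _ _ hω]
    · simp [hω]
  · refine ENNReal.le_of_forall_pos_le_add fun ε hε _ => ?_
    obtain ⟨L, hL⟩ := (ha0.eventually (gt_mem_nhds (NNReal.coe_pos.2 hε))).exists_forall_of_atTop
    have hbound : ∀ n, ENNReal.ofReal (h b 0) ≤
        P {ω | m < count c X n ω} + ((∑ j ∈ Finset.range L, P {ω | X n ω = j}) + ε) := by
      intro n
      have hmeas' : ∀ j, NullMeasurableSet {ω | X n ω = j} P := fun j =>
        (hX.aemeasurable hp n).nullMeasurableSet_preimage (measurableSet_singleton j)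
      calc ENNReal.ofReal (h b 0)
          = ∫⁻ ω, ENNReal.ofReal (h (X n ω) (count c X n ω)) ∂P := (hconst n).symm
        _ ≤ ∫⁻ ω, ({ω | m < count c X n ω}.indicator 1 ω +
            ((∑ j ∈ Finset.range L, {ω | X n ω = j}.indicator 1 ω) + (ε : ℝ≥0∞))) ∂P := by
          refine lintegral_mono fun ω => ?_
          have hle1 : ENNReal.ofReal (h (X n ω) (count c X n ω)) ≤ 1 := by
            rw [← ENNReal.ofReal_one]
            exact ENNReal.ofReal_le_ofReal (hle _ _)
          by_cases hω : m < count c X n ω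
          · refine hle1.trans (le_trans ?_ le_self_add)
            simp [hω]
          · refine le_trans ?_ le_add_self
            by_cases hXL : X n ω < L
            · refine hle1.trans (le_trans ?_ le_self_add)
              refine le_trans ?_ (Finset.single_le_sum (fun _ _ => zero_le)
                (Finset.mem_range.2 hXL))
              simp
            · refine le_trans ?_ le_add_self
              rw [← ENNReal.ofReal_coe_nnreal]
              exact ENNReal.ofReal_le_ofReal
                ((ha _ _ (not_lt.1 hω)).trans (hL _ (not_lt.1 hXL)).le)
        _ = _ := by
          have hind : ∀ {s : Set Ω}, NullMeasurableSet s P →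
              AEMeasurable (fun ω => s.indicator (1 : Ω → ℝ≥0∞) ω) P := fun hs =>
            aemeasurable_one.indicator₀ hs
          rw [lintegral_add_left' (hind (hmeas n)),
            lintegral_add_right' _ aemeasurable_const, lintegral_finsetSum',
            lintegral_indicator_one₀ (hmeas n), lintegral_const, measure_univ, mul_one]
          · simp only [lintegral_indicator_one₀ (hmeas' _)]
          · exact fun j _ => hind (hmeas' j)
    have hsum0 : Tendsto (fun n => ∑ j ∈ Finset.range L, P {ω | X n ω = j}) atTop (𝓝 0) := by
      simpa using tendsto_finsetSum (Finset.range L) fun j _ => hvanish j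
    have := ge_of_tendsto' (hlim.add (hsum0.add_const (ε : ℝ≥0∞))) hbound
    simpa using this

end Counting

end NNRW

namespace NNRW

section Potential

variable {p : ℕ → ℝ}

theorem E_pos (hp : ∀ i, 1 ≤ i → 0 ≤ p i ∧ p i < 1 / 2) (i : ℕ) : 0 < E p i := by
  unfold E
  split_ifs with h
  · exact zero_lt_one
  · linarith [(hp i (Nat.one_le_iff_ne_zero.2 h)).1]

theorem U_pos (hp : ∀ i, 1 ≤ i → 0 ≤ p i ∧ p i < 1 / 2) {i : ℕ} (hi : 1 ≤ i) : 0 < U p i :=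
  div_pos (by linarith [(hp i hi).2]) (by linarith [(hp i hi).1])

/-- The product `U 1 * ⋯ * U j`. -/
def weight (p : ℕ → ℝ) (j : ℕ) : ℝ := ∏ i ∈ Finset.Icc 1 j, U p i

theorem weight_succ (p : ℕ → ℝ) (j : ℕ) : weight p (j + 1) = weight p j * U p (j + 1) :=
  Finset.prod_Icc_succ_top (by omega) _

theorem weight_pos (hp : ∀ i, 1 ≤ i → 0 ≤ p i ∧ p i < 1 / 2) (j : ℕ) : 0 < weight p j :=
  Finset.prod_pos fun _ hi => U_pos hp (Finset.mem_Icc.1 hi).1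

theorem weight_add (p : ℕ → ℝ) (m j : ℕ) :
    weight p (m + j) = weight p m * ∏ i ∈ Finset.Icc 1 j, U p (m + i) := by
  induction j with
  | zero => simp
  | succ j ih =>
    rw [Finset.prod_Icc_succ_top (by omega), ← mul_assoc, ← ih, ← add_assoc, weight_succ]

theorem summable_weight (hp : ∀ i, 1 ≤ i → 0 ≤ p i ∧ p i < 1 / 2) (htrans : Dinf p 0 < ⊤) :
    Summable (weight p) := by
  rw [← summable_nat_add_iff 1]
  have h := ENNReal.summable_toReal ((ENNReal.add_lt_top.1 htrans).2.ne)
  refine h.congr fun j => ?_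
  simp only [zero_add]
  exact ENNReal.toReal_ofReal (weight_pos hp (j + 1)).le

/-- The tail `∑_{j ≥ i} U 1 * ⋯ * U j`. -/
def tail (p : ℕ → ℝ) (i : ℕ) : ℝ := ∑' j, weight p (j + i)

theorem tail_eq (hs : Summable (weight p)) (i : ℕ) : tail p i = weight p i + tail p (i + 1) := by
  rw [tail, ((summable_nat_add_iff i).2 hs).tsum_eq_zero_add, zero_add, tail]
  simp only [add_assoc, add_comm 1 i]

theorem tail_nonneg (hp : ∀ i, 1 ≤ i → 0 ≤ p i ∧ p i < 1 / 2) (i : ℕ) : 0 ≤ tail p i :=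
  tsum_nonneg fun _ => (weight_pos hp _).le

theorem tail_pos (hp : ∀ i, 1 ≤ i → 0 ≤ p i ∧ p i < 1 / 2) (hs : Summable (weight p)) (i : ℕ) :
    0 < tail p i := by
  rw [tail_eq hs]
  exact add_pos_of_pos_of_nonneg (weight_pos hp i) (tail_nonneg hp _)

theorem tail_antitone (hp : ∀ i, 1 ≤ i → 0 ≤ p i ∧ p i < 1 / 2) (hs : Summable (weight p)) :
    Antitone (tail p) :=
  antitone_nat_of_succ_le fun i => by linarith [tail_eq hs i, weight_pos hp i]

theorem Dinf_eq (hp : ∀ i, 1 ≤ i → 0 ≤ p i ∧ p i < 1 / 2) (hs : Summable (weight p)) (R : ℕ) :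
    Dinf p R = ENNReal.ofReal (tail p R / weight p R) := by
  have hw := weight_pos hp R
  have hterm : ∀ j, ∏ i ∈ Finset.Icc 1 (j + 1), U p (R + i) =
      weight p (j + (R + 1)) / weight p R := fun j => by
    rw [eq_div_iff hw.ne', mul_comm, ← weight_add]
    congr 1
    omega
  simp only [Dinf, hterm]
  rw [← ENNReal.ofReal_tsum_of_nonneg (fun j => (div_pos (weight_pos hp _) hw).le)
    (((summable_nat_add_iff (R + 1)).2 hs).div_const _), tsum_div_const, ← ENNReal.ofReal_one,
    ← tail,
    ← ENNReal.ofReal_add zero_le_one (div_nonneg (tail_nonneg hp (R + 1)) hw.le), tail_eq hs R,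
    add_div, div_self hw.ne']

theorem E_mul_weight (hp : ∀ i, 1 ≤ i → 0 ≤ p i ∧ p i < 1 / 2) (i : ℕ) :
    E p (i + 1) * weight p (i + 1) = (1 - E p (i + 1)) * weight p i := by
  have h := (hp (i + 1) (by omega)).1
  have h2 : (1 / 2 + p (i + 1)) ≠ 0 := by linarith
  rw [weight_succ, E, if_neg (by omega), U]
  field_simp
  ring

/-- The function `i ↦ tail p (max i R)` is harmonic for the walk except at `R`. -/
theorem mean_tail_max (hp : ∀ i, 1 ≤ i → 0 ≤ p i ∧ p i < 1 / 2) (hs : Summable (weight p))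
    (R i : ℕ) :
    E p i * tail p (max (i + 1) R) + (1 - E p i) * tail p (max (i - 1) R) =
      tail p (max i R) - if i = R then E p R * weight p R else 0 := by
  rcases lt_trichotomy i R with h | rfl | h
  · rw [max_eq_right (by omega), max_eq_right (by omega), max_eq_right h.le, if_neg h.ne]
    ring
  · rw [max_eq_left (by omega), max_eq_right (by omega), max_self, if_pos rfl, tail_eq hs i]
    ring
  · obtain ⟨i, rfl⟩ := Nat.exists_eq_succ_of_ne_zero (by omega : i ≠ 0)
    rw [Nat.succ_eq_add_one, Nat.add_sub_cancel, max_eq_left (by omega), max_eq_left (by omega),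
      max_eq_left (by omega), if_neg (by omega), tail_eq hs i, tail_eq hs (i + 1)]
    linarith [E_mul_weight hp i]

theorem tendsto_tail (p : ℕ → ℝ) : Tendsto (tail p) atTop (𝓝 0) :=
  tendsto_sum_nat_add (weight p)

theorem tendsto_tail_div_weight (hp : ∀ i, 1 ≤ i → 0 ≤ p i ∧ p i < 1 / 2)
    (hs : Summable (weight p)) (hplim : Tendsto p atTop (𝓝 0)) :
    Tendsto (fun R => tail p R / weight p R) atTop atTop := by
  have hU : Tendsto (U p) atTop (𝓝 1) := by
    have h := (hplim.const_sub (1 / 2)).div (hplim.const_add (1 / 2)) (by norm_num)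
    rw [sub_zero, add_zero, div_self (by norm_num)] at h
    exact h
  have hsum : ∀ K : ℕ, Tendsto (fun R => ∑ j ∈ Finset.range K, ∏ i ∈ Finset.Icc 1 j, U p (R + i))
      atTop (𝓝 K) := fun K => by
    have h := tendsto_finsetSum (Finset.range K) fun j _ =>
      tendsto_finsetProd (Finset.Icc 1 j) fun i _ => (tendsto_add_atTop_iff_nat i).2 hU
    simpa using h
  refine tendsto_atTop.2 fun b => ?_
  obtain ⟨K, hK⟩ := exists_nat_gt b
  filter_upwards [(hsum K).eventually (lt_mem_nhds hK)] with R hR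
  refine hR.le.trans ?_
  have hw := weight_pos hp R
  rw [le_div_iff₀ hw, Finset.sum_mul]
  refine le_trans (Finset.sum_le_sum fun j _ => ?_)
    (((summable_nat_add_iff R).2 hs).sum_le_tsum (Finset.range K)
      fun j _ => (weight_pos hp (j + R)).le)
  rw [mul_comm, ← weight_add, add_comm]

end Potential

section Law

variable {p : ℕ → ℝ} {Ω : Type*} [MeasurableSpace Ω] {P : Measure Ω} [IsProbabilityMeasure P]
  {X : ℕ → Ω → ℕ}

theorem IsNNWalk.tendsto_measure_eq_zero (hp : ∀ i, 1 ≤ i → 0 ≤ p i ∧ p i < 1 / 2)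
    (hs : Summable (weight p)) {b : ℕ} (hX : IsNNWalk P X p b) (j : ℕ) :
    Tendsto (fun n => P {ω | X n ω = j}) atTop (𝓝 0) := by
  refine hX.tendsto_measure_eq hp (g := fun i => tail p (max i j)) j (fun i => tail_nonneg hp _)
    (mul_pos (E_pos hp j) (weight_pos hp j)) fun i => ?_
  rw [mean_tail_max hp hs]
  linarith

/-- The general form of the law of the counter: `ρ` is the probability that one more count
follows. -/
theorem IsNNWalk.measure_exists_lt_count_eq_pow (hp : ∀ i, 1 ≤ i → 0 ≤ p i ∧ p i < 1 / 2)
    (hs : Summable (weight p)) (hX : IsNNWalk P X p 0) {R : ℕ}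
    (c : ℕ → ℕ → Prop) [∀ i j, Decidable (c i j)] {ρ : ℝ} (h0 : 0 ≤ ρ) (h1 : ρ ≤ 1)
    (hc : ∀ i j, c i j → i = R)
    (hR : ∀ m k, k ≤ m → next c p (fun i k => if m < k then 1 else
      tail p (max i R) / tail p R * ρ ^ (m - k)) R k = ρ ^ (m - k)) (m : ℕ) :
    P {ω | ∃ n, m < count c X n ω} = ENNReal.ofReal (ρ ^ m) := by
  have ht := tail_pos hp hs R
  have ha0 : ∀ i, 0 ≤ tail p (max i R) / tail p R := fun i => div_nonneg (tail_nonneg hp _) ht.le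
  have ha1 : ∀ i, tail p (max i R) / tail p R ≤ 1 := fun i =>
    (div_le_one ht).2 (tail_antitone hp hs (le_max_right i R))
  rw [hX.measure_exists_lt_count c hp (hX.tendsto_measure_eq_zero hp hs) (m := m)
    (h := fun i k => if m < k then 1 else tail p (max i R) / tail p R * ρ ^ (m - k))
    (a := fun i => tail p (max i R) / tail p R)]
  · simp [div_self ht.ne']
  · intro i k
    split_ifs
    · exact zero_le_one
    · exact mul_nonneg (ha0 i) (pow_nonneg h0 _)
  · exact fun i k hk => if_pos hk
  · intro i k
    split_ifs
    · exact le_rfl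
    · exact mul_le_one₀ (ha1 i) (pow_nonneg h0 _) (pow_le_one₀ h0 h1)
  · intro i k hk
    rw [if_neg (not_lt.2 hk)]
    exact mul_le_of_le_one_right (ha0 i) (pow_le_one₀ h0 h1)
  · have h := ((tendsto_tail p).comp
      (tendsto_atTop_mono (fun i => le_max_left i R) tendsto_id)).div_const (tail p R)
    simpa using h
  · intro i k
    by_cases hk : m < k
    · simp [next, hk, Nat.lt_add_right]
    · by_cases hi : i = R
      · subst hi
        rw [hR m k (not_lt.1 hk), if_neg hk, max_self, div_self ht.ne', one_mul]
      · have h := mean_tail_max hp hs R i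
        rw [if_neg hi, sub_zero] at h
        simp only [next, if_neg fun h => hi (hc i _ h), add_zero, if_neg hk]
        rw [← h]
        ring

/-- The number of visits to `R` is geometric. -/
theorem IsNNWalk.measure_exists_lt_count_visits (hp : ∀ i, 1 ≤ i → 0 ≤ p i ∧ p i < 1 / 2)
    (hs : Summable (weight p)) (hX : IsNNWalk P X p 0) (R m : ℕ) :
    P {ω | ∃ n, m < count (fun i _ => i = R) X n ω} =
      ENNReal.ofReal ((1 - E p R / (tail p R / weight p R)) ^ m) := by
  have ht := tail_pos hp hs R
  have hw := weight_pos hp R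
  have hwt : weight p R ≤ tail p R := by linarith [tail_eq hs R, tail_nonneg hp (R + 1)]
  have hq : 1 - E p R / (tail p R / weight p R) = (tail p R - E p R * weight p R) / tail p R := by
    field_simp
  refine hX.measure_exists_lt_count_eq_pow hp hs (R := R) _ ?_ ?_ (fun i _ h => h) ?_ m
  · rw [hq]
    refine div_nonneg ?_ ht.le
    nlinarith [E_le_one hp R]
  · have := div_nonneg (E_nonneg hp R) (div_nonneg ht.le hw.le)
    linarith
  · intro m k hk
    simp only [next, if_true]
    rcases hk.eq_or_lt with rfl | hk
    · simp
    · have h := mean_tail_max hp hs R R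
      rw [if_pos rfl, max_self] at h
      rw [if_neg (by omega), if_neg (by omega), hq]
      have hpow : m - k = (m - (k + 1)) + 1 := by omega
      rw [hpow, pow_succ, ← h]
      ring

/-- The number of upcrossings at `R` is geometric. -/
theorem IsNNWalk.measure_exists_lt_count_upcross (hp : ∀ i, 1 ≤ i → 0 ≤ p i ∧ p i < 1 / 2)
    (hs : Summable (weight p)) (hX : IsNNWalk P X p 0) (R m : ℕ) :
    P {ω | ∃ n, m < count (fun i j => i = R ∧ j = R + 1) X n ω} =
      ENNReal.ofReal ((1 - 1 / (tail p R / weight p R)) ^ m) := by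
  have ht := tail_pos hp hs R
  have hw := weight_pos hp R
  have hr : 1 - 1 / (tail p R / weight p R) = tail p (R + 1) / tail p R := by
    rw [one_div_div, eq_div_iff ht.ne', sub_mul, div_mul_cancel₀ _ ht.ne']
    linarith [tail_eq hs R]
  rw [hr]
  refine hX.measure_exists_lt_count_eq_pow hp hs (R := R) _ (div_nonneg (tail_nonneg hp _) ht.le)
    ((div_le_one ht).2 (tail_antitone hp hs (Nat.le_succ R))) (fun i _ h => h.1) ?_ m
  intro m k hk
  have hne : ¬ R - 1 = R + 1 := by omega
  simp only [next, hne, and_false, and_self, if_true, if_false, add_zero, if_neg (not_lt.2 hk),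
    max_eq_left (Nat.le_succ R), max_eq_right (Nat.sub_le R 1), div_self ht.ne']
  rcases hk.eq_or_lt with rfl | hk
  · simp
  · have hpow : m - k = (m - (k + 1)) + 1 := by omega
    rw [if_neg (by omega), hpow, pow_succ]
    ring

end Law

section Limit

theorem ofReal_lt_tsum_div_iff {f : ℕ → ℕ} {x D : ℝ} (hx : 0 ≤ x) (hD : 0 < D) :
    ENNReal.ofReal x < (∑' k, (f k : ℝ≥0∞)) / ENNReal.ofReal D ↔
      ∃ n, ⌊x * D⌋₊ < ∑ k ∈ Finset.range n, f k := by
  rw [ENNReal.lt_div_iff_mul_lt (Or.inl (by simpa using hD)) (Or.inl ENNReal.ofReal_ne_top),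
    ← ENNReal.ofReal_mul hx, ENNReal.tsum_eq_iSup_nat, lt_iSup_iff]
  refine exists_congr fun n => ?_
  rw [Nat.floor_lt (mul_nonneg hx hD.le), ← Nat.cast_sum, ← ENNReal.ofReal_natCast,
    ENNReal.ofReal_lt_ofReal_iff_of_nonneg (mul_nonneg hx hD.le)]

theorem tendsto_one_sub_pow_floor {a y : ℕ → ℝ} {x : ℝ} (ha : Tendsto a atTop (𝓝 0))
    (ha0 : ∀ n, 0 < a n) (hy : ∀ n, 0 ≤ y n) (hya : Tendsto (fun n => y n * a n) atTop (𝓝 x)) :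
    Tendsto (fun n => (1 - a n) ^ ⌊y n⌋₊) atTop (𝓝 (Real.exp (-x))) := by
  have hfloor : Tendsto (fun n => (⌊y n⌋₊ : ℝ) * a n) atTop (𝓝 x) := by
    refine tendsto_of_tendsto_of_tendsto_of_le_of_le (g := fun n => y n * a n - a n)
      (by simpa using hya.sub ha) hya (fun n => ?_) fun n => ?_
    · have := mul_le_mul_of_nonneg_right (Nat.lt_floor_add_one (y n)).le (ha0 n).le
      dsimp only
      linarith
    · exact mul_le_mul_of_nonneg_right (Nat.floor_le (hy n)) (ha0 n).le
  have hlog : Tendsto (fun n => Real.log (1 - a n) / a n) atTop (𝓝 (-1)) := by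
    have hslope := (Real.hasDerivAt_log one_ne_zero).tendsto_slope_zero
    have hneg : Tendsto (fun n => -a n) atTop (𝓝[≠] 0) :=
      tendsto_nhdsWithin_iff.2 ⟨by simpa using ha.neg,
        Eventually.of_forall fun n => neg_ne_zero.2 (ha0 n).ne'⟩
    have h := (hslope.comp hneg).neg
    simp only [inv_one] at h
    refine h.congr fun n => ?_
    simp only [Function.comp_apply, Real.log_one, sub_zero, smul_eq_mul, inv_neg, ← sub_eq_add_neg]
    rw [neg_mul, neg_neg, div_eq_inv_mul]
  have hexp := (Real.continuous_exp.tendsto _).comp (hfloor.mul hlog)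
  rw [mul_neg_one] at hexp
  refine hexp.congr' ?_
  filter_upwards [ha.eventually (gt_mem_nhds zero_lt_one)] with n hn
  have hpos : 0 < 1 - a n := sub_pos.2 hn
  have h1 : (⌊y n⌋₊ : ℝ) * a n * (Real.log (1 - a n) / a n) =
      ⌊y n⌋₊ * Real.log (1 - a n) := by
    have := (ha0 n).ne'
    field_simp
  rw [Function.comp_apply, h1, Real.exp_nat_mul, Real.exp_log hpos]

variable {Ω : Type*} (X : ℕ → Ω → ℕ) (R : ℕ)

theorem setOf_lt_localTime_div {x D : ℝ} (hx : 0 ≤ x) (hD : 0 < D) :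
    {ω | ENNReal.ofReal x < localTime X R ω / ENNReal.ofReal D} =
      {ω | ∃ n, ⌊x * D⌋₊ < count (fun i _ => i = R) X n ω} := by
  ext ω
  refine Iff.trans (Eq.to_iff ?_) (ofReal_lt_tsum_div_iff hx hD)
  simp [localTime, Set.indicator_apply]

theorem setOf_lt_upcross_div {x D : ℝ} (hx : 0 ≤ x) (hD : 0 < D) :
    {ω | ENNReal.ofReal x < upcross X R ω / ENNReal.ofReal D} =
      {ω | ∃ n, ⌊x * D⌋₊ < count (fun i j => i = R ∧ j = R + 1) X n ω} := by
  ext ω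
  refine Iff.trans (Eq.to_iff ?_) (ofReal_lt_tsum_div_iff hx hD)
  simp [upcross, Set.indicator_apply]

end Limit

end NNRW

/-- for a transient chain with `p_R → 0`, `ξ(R,∞)/(2D(R,∞))` and
`ξ(R,∞,↑)/D(R,∞)` have exponential limiting distributions. -/
theorem stmt10 (p : ℕ → ℝ) (hp : ∀ i, 1 ≤ i → 0 ≤ p i ∧ p i < 1 / 2)
    (htrans : Dinf p 0 < ⊤) (hplim : Tendsto p atTop (𝓝 0))
    (Ω : Type) [MeasurableSpace Ω] (P : Measure Ω) [IsProbabilityMeasure P]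
    (X : ℕ → Ω → ℕ) (hX : IsNNWalk P X p 0) :
    ∀ x : ℝ, 0 < x →
      Tendsto (fun R : ℕ => P {ω | ENNReal.ofReal x < localTime X R ω / (2 * Dinf p R)})
          atTop (𝓝 (ENNReal.ofReal (Real.exp (-x)))) ∧
        Tendsto (fun R : ℕ => P {ω | ENNReal.ofReal x < upcross X R ω / Dinf p R})
          atTop (𝓝 (ENNReal.ofReal (Real.exp (-x)))) := by
  intro x hx
  have hs := summable_weight hp htrans
  have hpos : ∀ R, 0 < tail p R / weight p R := fun R =>
    div_pos (tail_pos hp hs R) (weight_pos hp R)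
  have htop := tendsto_tail_div_weight hp hs hplim
  have hE : Tendsto (E p) atTop (𝓝 (1 / 2)) := by
    have h := hplim.const_add (1 / 2)
    rw [add_zero] at h
    refine h.congr' ?_
    filter_upwards [eventually_ne_atTop 0] with i hi
    rw [E, if_neg hi]
  constructor
  · have hlaw : ∀ R, P {ω | ENNReal.ofReal x < localTime X R ω / (2 * Dinf p R)} =
        ENNReal.ofReal ((1 - E p R / (tail p R / weight p R)) ^
          ⌊x * (2 * (tail p R / weight p R))⌋₊) := fun R => by
      rw [Dinf_eq hp hs, ← ENNReal.ofReal_ofNat 2, ← ENNReal.ofReal_mul zero_le_two,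
        setOf_lt_localTime_div X R hx.le (mul_pos two_pos (hpos R)),
        hX.measure_exists_lt_count_visits hp hs]
    simp only [hlaw]
    refine ENNReal.tendsto_ofReal (tendsto_one_sub_pow_floor (hE.div_atTop htop)
      (fun R => div_pos (E_pos hp R) (hpos R))
      (fun R => mul_nonneg hx.le (mul_nonneg zero_le_two (hpos R).le)) ?_)
    have h := hE.const_mul (2 * x)
    rw [show 2 * x * (1 / 2) = x by ring] at h
    refine h.congr fun R => ?_
    rw [mul_div_assoc', eq_div_iff (hpos R).ne']
    ring
  · have hlaw : ∀ R, P {ω | ENNReal.ofReal x < upcross X R ω / Dinf p R} =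
        ENNReal.ofReal ((1 - 1 / (tail p R / weight p R)) ^
          ⌊x * (tail p R / weight p R)⌋₊) := fun R => by
      rw [Dinf_eq hp hs, setOf_lt_upcross_div X R hx.le (hpos R),
        hX.measure_exists_lt_count_upcross hp hs]
    simp only [hlaw]
    refine ENNReal.tendsto_ofReal (tendsto_one_sub_pow_floor
      (tendsto_const_nhds.div_atTop htop) (fun R => div_pos one_pos (hpos R))
      (fun R => mul_nonneg hx.le (hpos R).le) ?_)
    refine tendsto_const_nhds.congr fun R => ?_
    rw [mul_one_div, mul_div_cancel_right₀ _ (hpos R).ne']
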